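/- Let G be a colored multigraph whose edge multiset E contains bichrome edges (u,v), (u,z), (w,x) with u, v, z, w, x pairwise distinct, λ(u) = λ(w) = ℓ, and λ(v), λ(z), λ(x) all different from ℓ. Then the three DESs ⟨(u,z),(w,x) → (u,x),(w,z)⟩, ⟨(u,v),(w,z) → (u,z),(w,v)⟩, and ⟨(u,x),(w,v) → (u,v),(w,x)⟩ can be applied in this order starting from G, each of them is a JDES, and their composite returns the original multigraph G; hence the state space contains a closed walk of length 3 (in addition to the closed walks of length 2 given by reversibility of JDESs). -/

import Mathlib

open Multiset

variable {V L : Type*}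

/-- Degree of a vertex in an edge multiset: number of edge-endpoint incidences,
a self-loop contributing 2. -/
def mdeg [DecidableEq V] (E : Multiset (Sym2 V)) (u : V) : ℕ :=
  (E.map (Sym2.lift ⟨fun a b => (if a = u then 1 else 0) + (if b = u then 1 else 0),
    fun _ _ => add_comm _ _⟩)).sum

/-- Colored degree `d^ℓ(u)`: incidences of `u` with edges whose other endpoint has color `ℓ`;
a self-loop at `u` contributes 2 to `d^{lam u}(u)`. -/
def cdeg [DecidableEq V] [DecidableEq L] (lam : V → L) (E : Multiset (Sym2 V))
    (u : V) (ℓ : L) : ℕ :=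
  (E.map (Sym2.lift ⟨fun a b =>
      (if a = u ∧ lam b = ℓ then 1 else 0) + (if b = u ∧ lam a = ℓ then 1 else 0),
    fun _ _ => add_comm _ _⟩)).sum

/-- Joint color matrix entry `J[ℓ,r]`: number of edges (with multiplicity) whose endpoint
colors are `ℓ` and `r`. -/
def JCM [DecidableEq L] (lam : V → L) (E : Multiset (Sym2 V)) (ℓ r : L) : ℕ :=
  Multiset.count s(ℓ, r) (E.map (Sym2.map lam))

/-- Result of the double edge swap removing `(u,w),(v,z)` and adding `(u,z),(w,v)`. -/
def desApply [DecidableEq V] (E : Multiset (Sym2 V)) (u w v z : V) : Multiset (Sym2 V) :=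
  (E - {s(u,w), s(v,z)}) + {s(u,z), s(w,v)}

/-- The DES removing `(u,w),(v,z)` (two distinct members of `E`) and adding `(u,z),(w,v)`
is applicable to `E` and preserves the JCM. -/
def IsJDES [DecidableEq V] [DecidableEq L] (lam : V → L) (E : Multiset (Sym2 V))
    (u w v z : V) : Prop :=
  ({s(u,w), s(v,z)} : Multiset (Sym2 V)) ≤ E ∧
    ∀ ℓ r, JCM lam (desApply E u w v z) ℓ r = JCM lam E ℓ r

/-- One step of the JDES relation between edge multisets (on the same vertex set,
with the same coloring). -/
def JDESStep [DecidableEq V] [DecidableEq L] (lam : V → L)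
    (E E' : Multiset (Sym2 V)) : Prop :=
  ∃ u w v z, IsJDES lam E u w v z ∧ E' = desApply E u w v z

/-- Sub-multiset of edges incident to at least one vertex of color `ℓ`. -/
def EClass [DecidableEq L] (lam : V → L) (ℓ : L) (E : Multiset (Sym2 V)) :
    Multiset (Sym2 V) :=
  E.filter (fun e => ℓ ∈ Sym2.map lam e)

/-- `Δ(Q,R)`: total colored-degree discrepancy. -/
def Delta [Fintype V] [Fintype L] [DecidableEq V] [DecidableEq L]
    (lam : V → L) (E E' : Multiset (Sym2 V)) : ℕ :=
  ∑ u : V, ∑ ℓ : L, ((cdeg lam E u ℓ : ℤ) - (cdeg lam E' u ℓ : ℤ)).natAbs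

theorem desApply_pair_add [DecidableEq V] (R : Multiset (Sym2 V)) (u w v z : V) :
    desApply ({s(u,w), s(v,z)} + R) u w v z = {s(u,z), s(w,v)} + R := by
  rw [desApply, add_tsub_cancel_left, add_comm]

/-- A swap of edges `(u,w)` and `(v,z)` whose endpoints `u` and `v` have the same color
preserves the joint color matrix. -/
theorem isJDES_pair_add [DecidableEq V] [DecidableEq L] (lam : V → L)
    (R : Multiset (Sym2 V)) {u v : V} (w z : V) (huv : lam u = lam v) :
    IsJDES lam ({s(u,w), s(v,z)} + R) u w v z := by
  refine ⟨Multiset.le_add_right _ _, fun ℓ r => ?_⟩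
  rw [desApply_pair_add]
  simp only [JCM, Multiset.map_add, Multiset.insert_eq_cons, Multiset.map_cons,
    Multiset.map_singleton, Sym2.map_mk, huv]
  rw [Sym2.eq_swap (a := lam w), ← Multiset.insert_eq_cons, Multiset.pair_comm,
    Multiset.insert_eq_cons]

/-- If `E` contains bichrome edges `(u,v)`, `(u,z)`, `(w,x)` with
`u,v,z,w,x` pairwise distinct, `λ(u) = λ(w) = ℓ`, and `λ(v), λ(z), λ(x)` all different
from `ℓ`, then the three DESs `⟨(u,z),(w,x) → (u,x),(w,z)⟩`,
`⟨(u,v),(w,z) → (u,z),(w,v)⟩`, `⟨(u,x),(w,v) → (u,v),(w,x)⟩` can be applied in this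
order, each is a JDES, and their composite returns the original multigraph: a closed
walk of length 3 in the state space. -/
theorem bichrome_triangle {V L : Type*} [DecidableEq V] [DecidableEq L]
    (lam : V → L) (E : Multiset (Sym2 V)) (u v z w x : V) (ℓ : L)
    (h1 : s(u,v) ∈ E) (h2 : s(u,z) ∈ E) (h3 : s(w,x) ∈ E)
    (hdist : ([u, v, z, w, x] : List V).Pairwise (· ≠ ·))
    (hu : lam u = ℓ) (hw : lam w = ℓ)
    (hv : lam v ≠ ℓ) (hz : lam z ≠ ℓ) (hx : lam x ≠ ℓ) :
    IsJDES lam E u z w x ∧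
      IsJDES lam (desApply E u z w x) u v w z ∧
      IsJDES lam (desApply (desApply E u z w x) u v w z) u x w v ∧
      desApply (desApply (desApply E u z w x) u v w z) u x w v = E := by
  have hsub : ({s(u,v), s(u,z), s(w,x)} : Multiset (Sym2 V)) ≤ E := by
    rw [Multiset.le_iff_subset]
    · intro e he
      simp only [Multiset.insert_eq_cons, Multiset.mem_cons, Multiset.mem_singleton] at he
      rcases he with rfl | rfl | rfl <;> assumption
    · simp only [List.pairwise_cons, List.mem_cons] at hdist
      simp only [Multiset.insert_eq_cons, Multiset.nodup_cons, Multiset.mem_cons,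
        Multiset.mem_singleton, Multiset.nodup_singleton, Sym2.eq_iff]
      grind
  obtain ⟨R, rfl⟩ := Multiset.le_iff_exists_add.mp hsub
  have huw : lam u = lam w := hu.trans hw.symm
  have e₀ : ({s(u,v), s(u,z), s(w,x)} : Multiset (Sym2 V)) + R =
      {s(u,z), s(w,x)} + (s(u,v) ::ₘ R) := by
    ext e; simp [Multiset.count_cons]
  have e₁ : ({s(u,x), s(z,w)} : Multiset (Sym2 V)) + (s(u,v) ::ₘ R) =
      {s(u,v), s(w,z)} + (s(u,x) ::ₘ R) := by
    rw [Sym2.eq_swap (a := z)]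
    ext e; simp [Multiset.count_cons]; ring
  have e₂ : ({s(u,z), s(v,w)} : Multiset (Sym2 V)) + (s(u,x) ::ₘ R) =
      {s(u,x), s(w,v)} + (s(u,z) ::ₘ R) := by
    rw [Sym2.eq_swap (a := v)]
    ext e; simp [Multiset.count_cons]; ring
  have e₃ : ({s(u,v), s(x,w)} : Multiset (Sym2 V)) + (s(u,z) ::ₘ R) =
      {s(u,z), s(w,x)} + (s(u,v) ::ₘ R) := by
    rw [Sym2.eq_swap (a := x)]
    ext e; simp [Multiset.count_cons]; ring
  simp only [e₀, desApply_pair_add, e₁, e₂, e₃]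
  exact ⟨isJDES_pair_add lam _ z x huw, isJDES_pair_add lam _ v z huw,
    isJDES_pair_add lam _ x v huw, trivial⟩
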